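/- Let V be a countably infinite set, (V,E) a directed acyclic graph, and ≤ the partial order on V induced by the transitive closure of (V,E). For any two probability measures μ₁, μ₂ on V the following three statements are equivalent: (1) μ₁ ⪯ μ₂; (2) there exists a coupling between μ₁ and μ₂ compatible with ≤; (3) there exists a finitely decomposable flow Q on (V,E) such that div Q = μ₁ − μ₂. -/

import Mathlib

open scoped BigOperators

variable {V : Type*}

/-- A directed path in the digraph `(V, E)`: a nonempty list of vertices whose
consecutive pairs are directed edges. -/
def IsDipath (E : Set (V × V)) (l : List V) : Prop :=
  l ≠ [] ∧ l.Chain' (fun a b => (a, b) ∈ E)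

/-- The list of directed edges of a path. -/
def pathEdges (l : List V) : List (V × V) := l.zip l.tail

/-- The unit flow `Q_γ` along a path: `1` on the edges of the path and `0` elsewhere. -/
noncomputable def pathFlow (l : List V) : V × V → ℝ :=
  Set.indicator {e | e ∈ pathEdges l} 1

/-- A flow on the digraph `(V, E)`: nonnegative and supported on `E`. -/
def IsFlow (E : Set (V × V)) (Q : V × V → ℝ) : Prop :=
  (∀ e, 0 ≤ Q e) ∧ ∀ e, e ∉ E → Q e = 0

/-- The divergence of a flow at a vertex. -/
noncomputable def divergence (Q : V × V → ℝ) (x : V) : ℝ :=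
  (∑' y, Q (x, y)) - ∑' y, Q (y, x)

/-- A relation is acyclic if it has no directed cycles. -/
def AcyclicRel (r : V → V → Prop) : Prop := ∀ x, ¬ Relation.TransGen r x x

/-- The edge relation of a digraph. -/
def edgeRel (E : Set (V × V)) : V → V → Prop := fun a b => (a, b) ∈ E

/-- The partial order induced by an acyclic digraph: `x ≤ y` iff `x = y` or there is
a directed path from `x` to `y`. -/
def inducedLE (E : Set (V × V)) : V → V → Prop :=
  Relation.ReflTransGen (edgeRel E)

/-- A finitely decomposable flow: a pointwise sum `∑ₙ qₙ Q_{γₙ}` over finite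
self-avoiding directed paths with summable nonnegative weights. -/
def FinDecomposable (E : Set (V × V)) (Q : V × V → ℝ) : Prop :=
  ∃ (γ : ℕ → List V) (q : ℕ → ℝ),
    (∀ n, IsDipath E (γ n)) ∧ (∀ n, (γ n).Nodup) ∧ (∀ n, 0 ≤ q n) ∧ Summable q ∧
    ∀ e, Q e = ∑' n, q n * pathFlow (γ n) e

/-- A probability measure on a countable set, as a nonnegative function of total sum `1`. -/
def IsProb (μ : V → ℝ) : Prop := (∀ x, 0 ≤ μ x) ∧ HasSum μ 1

/-- A coupling of `μ₁` and `μ₂`: a probability on `V × V` with the given marginals. -/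
def IsCoupling (μ₁ μ₂ : V → ℝ) (ρ : V × V → ℝ) : Prop :=
  (∀ p, 0 ≤ ρ p) ∧ (∀ x, HasSum (fun y => ρ (x, y)) (μ₁ x)) ∧
    ∀ y, HasSum (fun x => ρ (x, y)) (μ₂ y)

/-- Stochastic domination: `∑ f μ₁ ≤ ∑ f μ₂` for every bounded increasing `f`. -/
def StochDom (le : V → V → Prop) (μ₁ μ₂ : V → ℝ) : Prop :=
  ∀ f : V → ℝ, (∃ C, ∀ x, |f x| ≤ C) → (∀ x y, le x y → f x ≤ f y) →
    ∑' x, f x * μ₁ x ≤ ∑' x, f x * μ₂ x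

/-- Finite-case divergence. -/
noncomputable def divergenceF [Fintype V] (Q : V × V → ℝ) (x : V) : ℝ :=
  (∑ y, Q (x, y)) - ∑ y, Q (y, x)

/-- Probability measure on a finite set. -/
def IsProbF [Fintype V] (μ : V → ℝ) : Prop := (∀ x, 0 ≤ μ x) ∧ ∑ x, μ x = 1

/-- Coupling on a finite set. -/
def IsCouplingF [Fintype V] (μ₁ μ₂ : V → ℝ) (ρ : V × V → ℝ) : Prop :=
  (∀ p, 0 ≤ ρ p) ∧ (∀ x, ∑ y, ρ (x, y) = μ₁ x) ∧ ∀ y, ∑ x, ρ (x, y) = μ₂ y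

/-- Stochastic domination on a finite set. -/
def StochDomF [Fintype V] (le : V → V → Prop) (μ₁ μ₂ : V → ℝ) : Prop :=
  ∀ f : V → ℝ, (∀ x y, le x y → f x ≤ f y) → ∑ x, f x * μ₁ x ≤ ∑ x, f x * μ₂ x

/-- The cost of a path: the sum of the weights of its edges. -/
noncomputable def pathCost (w : V × V → ℝ) (l : List V) : ℝ := ((pathEdges l).map w).sum

/-- The geodesic cost associated to a weight function on a digraph. -/
noncomputable def geoCost (E : Set (V × V)) (w : V × V → ℝ) (x y : V) : ℝ :=
  sInf {r | ∃ l, IsDipath E l ∧ l.head? = some x ∧ l.getLast? = some y ∧ pathCost w l = r}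

lemma pathFlow_nonneg (l : List V) (e : V × V) : 0 ≤ pathFlow l e :=
  Set.indicator_nonneg (fun _ _ => zero_le_one) e

lemma pathFlow_singleton (a : V) (e : V × V) : pathFlow [a] e = 0 := by
  simp [pathFlow, pathEdges]

lemma mem_of_mem_pathEdges {l : List V} {x y : V} (h : (x, y) ∈ pathEdges l) : x ∈ l ∧ y ∈ l :=
  (List.of_mem_zip h).imp id List.mem_of_mem_tail

lemma pathFlow_eq_zero_of_notMem {E : Set (V × V)} {l : List V} (h : IsDipath E l)
    {e : V × V} (he : e ∉ E) : pathFlow l e = 0 := by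
  refine Set.indicator_of_notMem (fun hmem => he ?_) _
  obtain ⟨-, h⟩ := h
  change List.IsChain _ l at h
  induction l with
  | nil => simp [pathEdges] at hmem
  | cons a l ih =>
    cases l with
    | nil => simp [pathEdges] at hmem
    | cons b t =>
      rw [List.isChain_cons_cons] at h
      have hmem' : e = (a, b) ∨ e ∈ pathEdges (b :: t) := by simpa [pathEdges] using hmem
      rcases hmem' with rfl | hmem'
      · exact h.1
      · exact ih hmem' h.2

open Classical in
lemma pathFlow_cons_cons {a b : V} {t : List V} (ha : a ∉ b :: t) (e : V × V) :
    pathFlow (a :: b :: t) e = pathFlow (b :: t) e + if e = (a, b) then 1 else 0 := by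
  have hedges : e ∈ pathEdges (a :: b :: t) ↔ e = (a, b) ∨ e ∈ pathEdges (b :: t) := by
    simp [pathEdges]
  by_cases he : e = (a, b)
  · have hnot : e ∉ pathEdges (b :: t) := by
      subst he
      exact fun h => ha (mem_of_mem_pathEdges h).1
    have hmem : e ∈ pathEdges (a :: b :: t) := hedges.mpr (Or.inl he)
    simp only [pathFlow, Set.indicator, Set.mem_ofPred_eq, if_neg hnot, if_pos he, if_pos hmem,
      Pi.one_apply, zero_add]
  · simp [pathFlow, Set.indicator, hedges, he]

open Classical in
lemma hasSum_pathFlow_out {l : List V} (hne : l ≠ []) (hl : l.Nodup) (x : V) :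
    HasSum (fun y => pathFlow l (x, y))
      ((if x ∈ l then 1 else 0) - if x = l.getLast hne then 1 else 0) := by
  induction l with
  | nil => exact absurd rfl hne
  | cons a l ih =>
    cases l with
    | nil => by_cases h : x = a <;> simp [pathFlow_singleton, h, hasSum_zero]
    | cons b t =>
      rw [List.nodup_cons] at hl
      simp only [pathFlow_cons_cons hl.1, Prod.mk.injEq]
      have hab : HasSum (fun y => if x = a ∧ y = b then (1 : ℝ) else 0)
          (if x = a then 1 else 0) := by
        convert hasSum_ite_eq b (if x = a then (1 : ℝ) else 0) using 2 with y
        split_ifs <;> simp_all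
      convert (ih (by simp) hl.2).add hab using 1
      rw [List.getLast_cons_cons]
      by_cases hxa : x = a
      · subst hxa
        rw [if_neg hl.1]
        simp
        ring
      · simp [hxa]

open Classical in
lemma hasSum_pathFlow_in {l : List V} (hne : l ≠ []) (hl : l.Nodup) (x : V) :
    HasSum (fun y => pathFlow l (y, x))
      ((if x ∈ l then 1 else 0) - if x = l.head hne then 1 else 0) := by
  induction l with
  | nil => exact absurd rfl hne
  | cons a l ih =>
    cases l with
    | nil => by_cases h : x = a <;> simp [pathFlow_singleton, h, hasSum_zero]
    | cons b t =>
      rw [List.nodup_cons] at hl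
      simp only [pathFlow_cons_cons hl.1, Prod.mk.injEq]
      have hab : HasSum (fun y => if y = a ∧ x = b then (1 : ℝ) else 0)
          (if x = b then 1 else 0) := by
        convert hasSum_ite_eq a (if x = b then (1 : ℝ) else 0) using 2 with y
        split_ifs <;> simp_all
      convert (ih (by simp) hl.2).add hab using 1
      have hxa : x = a → x ∉ b :: t := fun h => h ▸ hl.1
      by_cases hx : x = a
      · have := hxa hx
        simp_all
      · by_cases hxb : x = b <;> simp [hx, hxb]
        subst hxb
        simp [hx]

/-- Superposing kernels of mass at most one with summable weights commutes with summation. -/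
lemma tsum_tsum_mul_comm {q : ℕ → ℝ} (hq : ∀ n, 0 ≤ q n) (hqs : Summable q)
    {k : ℕ → V → ℝ} (hk : ∀ n y, 0 ≤ k n y) {s : ℕ → ℝ} (hs : ∀ n, HasSum (k n) (s n))
    {C : ℝ} (hC : ∀ n, s n ≤ C) :
    ∑' y, ∑' n, q n * k n y = ∑' n, q n * s n ∧ Summable fun n => q n * s n := by
  have hs0 : ∀ n, 0 ≤ s n := fun n => (hs n).nonneg (hk n)
  have hsum : Summable fun n => q n * s n :=
    Summable.of_nonneg_of_le (fun n => mul_nonneg (hq n) (hs0 n))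
      (fun n => mul_le_mul_of_nonneg_left (hC n) (hq n)) (hqs.mul_right C)
  have hrow : ∀ n, HasSum (fun y => q n * k n y) (q n * s n) := fun n => (hs n).mul_left _
  have hjoint : Summable (Function.uncurry fun n y => q n * k n y) := by
    refine (summable_prod_of_nonneg fun p => mul_nonneg (hq p.1) (hk p.1 p.2)).mpr ?_
    exact ⟨fun n => (hrow n).summable, by simpa [Function.uncurry, (hrow _).tsum_eq] using hsum⟩
  refine ⟨?_, hsum⟩
  rw [hjoint.tsum_comm]
  exact tsum_congr fun n => (hrow n).tsum_eq

open Classical in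
lemma divergence_tsum_pathFlow {γ : ℕ → List V} {q : ℕ → ℝ} (hne : ∀ n, γ n ≠ [])
    (hnd : ∀ n, (γ n).Nodup) (hq : ∀ n, 0 ≤ q n) (hqs : Summable q) (x : V) :
    divergence (fun e => ∑' n, q n * pathFlow (γ n) e) x =
      (∑' n, q n * if x = (γ n).head (hne n) then 1 else 0) -
        ∑' n, q n * if x = (γ n).getLast (hne n) then 1 else 0 := by
  obtain ⟨hout, hout_sum⟩ := tsum_tsum_mul_comm (C := 1) hq hqs
    (fun n y => pathFlow_nonneg (γ n) (x, y))
    (fun n => hasSum_pathFlow_out (hne n) (hnd n) x) (fun n => by split_ifs <;> norm_num)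
  obtain ⟨hin, hin_sum⟩ := tsum_tsum_mul_comm (C := 1) hq hqs
    (fun n y => pathFlow_nonneg (γ n) (y, x))
    (fun n => hasSum_pathFlow_in (hne n) (hnd n) x) (fun n => by split_ifs <;> norm_num)
  have hind : ∀ v : ℕ → V, Summable fun n => q n * if x = v n then (1 : ℝ) else 0 := fun v =>
    Summable.of_nonneg_of_le (fun n => mul_nonneg (hq n) (by split_ifs <;> norm_num))
      (fun n => mul_le_of_le_one_right (hq n) (by split_ifs <;> norm_num)) hqs
  rw [divergence, hout, hin, ← hout_sum.tsum_sub hin_sum, ← (hind _).tsum_sub (hind _)]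
  exact tsum_congr fun n => by ring

open Classical in
/-- Change of variables for the push-forward of summable weights. -/
lemma hasSum_mul_tsum_ite {q : ℕ → ℝ} (hq : ∀ n, 0 ≤ q n) (hqs : Summable q) (v : ℕ → V)
    {f : V → ℝ} {C : ℝ} (hf : ∀ x, |f x| ≤ C) :
    HasSum (fun x => f x * ∑' n, q n * if x = v n then 1 else 0) (∑' n, q n * f (v n)) := by
  have hrow : ∀ g : V → ℝ, ∀ n, HasSum (fun x => q n * (g x * if x = v n then 1 else 0))
      (q n * g (v n)) := fun g n => by
    refine HasSum.mul_left _ ?_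
    have hite : ∀ x, (g x * if x = v n then 1 else 0) =
        if x = v n then g (v n) else 0 := fun x => by
      split_ifs <;> simp_all
    simpa only [hite] using hasSum_ite_eq (v n) (g (v n))
  have hjoint : Summable
      (Function.uncurry fun n x => q n * (f x * if x = v n then (1 : ℝ) else 0)) := by
    refine Summable.of_norm ?_
    have habs : ∀ p : ℕ × V,
        ‖Function.uncurry (fun n x => q n * (f x * if x = v n then (1 : ℝ) else 0)) p‖ =
          q p.1 * (|f p.2| * if p.2 = v p.1 then 1 else 0) := fun p => by
      simp only [Function.uncurry, norm_mul, Real.norm_eq_abs, abs_of_nonneg (hq p.1)]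
      split_ifs <;> simp
    simp only [habs]
    rw [summable_prod_of_nonneg fun p => habs p ▸ norm_nonneg _]
    refine ⟨fun n => (hrow (|f ·|) n).summable, ?_⟩
    simp only [(hrow (|f ·|) _).tsum_eq]
    exact Summable.of_nonneg_of_le (fun n => mul_nonneg (hq n) (abs_nonneg _))
      (fun n => mul_le_mul_of_nonneg_left (hf _) (hq n)) (hqs.mul_right C)
  have hcol : ∀ x, f x * ∑' n, q n * (if x = v n then (1 : ℝ) else 0) =
      ∑' n, q n * (f x * if x = v n then 1 else 0) := fun x => by
    rw [← tsum_mul_left]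
    exact tsum_congr fun n => by ring
  simp only [hcol]
  have h := hjoint.prod_symm.prod.hasSum
  simp only [Prod.swap, Function.uncurry] at h
  rwa [hjoint.tsum_comm, tsum_congr fun n => (hrow f n).tsum_eq] at h

lemma stochDom_of_finDecomposable {E : Set (V × V)} {μ₁ μ₂ : V → ℝ} (h₁ : IsProb μ₁)
    (h₂ : IsProb μ₂) {Q : V × V → ℝ} (hQ : FinDecomposable E Q)
    (hdiv : ∀ x, divergence Q x = μ₁ x - μ₂ x) : StochDom (inducedLE E) μ₁ μ₂ := by
  classical
  rintro f ⟨C, hC⟩ hmono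
  obtain ⟨γ, q, hγ, hnd, hq, hqs, hQe⟩ := hQ
  obtain rfl : Q = fun e => ∑' n, q n * pathFlow (γ n) e := funext hQe
  have hne : ∀ n, γ n ≠ [] := fun n => (hγ n).1
  have hμ : ∀ μ : V → ℝ, IsProb μ → Summable fun x => f x * μ x := fun μ h =>
    Summable.of_norm_bounded (h.2.summable.mul_left C) fun x => by
      rw [norm_mul, Real.norm_of_nonneg (h.1 x)]
      exact mul_le_mul_of_nonneg_right (hC x) (h.1 x)
  have hfq : ∀ v : ℕ → V, Summable fun n => q n * f (v n) := fun v =>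
    Summable.of_norm_bounded (hqs.mul_right C) fun n => by
      rw [norm_mul, Real.norm_of_nonneg (hq n)]
      exact mul_le_mul_of_nonneg_left (hC _) (hq n)
  have hsub := (hasSum_mul_tsum_ite hq hqs (fun n => (γ n).head (hne n)) hC).sub
    (hasSum_mul_tsum_ite hq hqs (fun n => (γ n).getLast (hne n)) hC)
  have hdiff := (hμ μ₁ h₁).hasSum.sub (hμ μ₂ h₂).hasSum
  have heq := hsub.unique <| by
    convert hdiff using 2 with x
    rw [← mul_sub, ← mul_sub, ← hdiv x, divergence_tsum_pathFlow hne hnd hq hqs]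
  have hle : ∑' n, q n * f ((γ n).head (hne n)) ≤ ∑' n, q n * f ((γ n).getLast (hne n)) := by
    refine (hfq _).tsum_le_tsum (fun n => mul_le_mul_of_nonneg_left (hmono _ _ ?_) (hq n)) (hfq _)
    exact (γ n).relationReflTransGen_of_exists_isChain (hγ n).2 (hne n)
  linarith

lemma exists_dipath_of_inducedLE {E : Set (V × V)} (hacyc : AcyclicRel (edgeRel E)) {x y : V}
    (h : inducedLE E x y) :
    ∃ l : List V, ∃ hne : l ≠ [], IsDipath E l ∧ l.Nodup ∧ l.head hne = x ∧ l.getLast hne = y := by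
  obtain ⟨l, hl, hlast⟩ := List.exists_isChain_cons_of_relationReflTransGen h
  refine ⟨x :: l, List.cons_ne_nil _ _, ⟨List.cons_ne_nil _ _, hl⟩, ?_, rfl, hlast⟩
  have hpair := (hl.imp fun _ _ hab => Relation.TransGen.single hab).pairwise
  exact List.Pairwise.imp (S := (· ≠ ·)) (fun {a b} hab heq => hacyc a (by rwa [← heq] at hab))
      hpair

lemma exists_finDecomposable_of_coupling [Countable V] [Infinite V] {E : Set (V × V)}
    (hacyc : AcyclicRel (edgeRel E)) {μ₁ μ₂ : V → ℝ} (h₁ : IsProb μ₁) {ρ : V × V → ℝ}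
    (hρ : IsCoupling μ₁ μ₂ ρ) (hle : ∀ p : V × V, ρ p ≠ 0 → inducedLE E p.1 p.2) :
    ∃ Q : V × V → ℝ, IsFlow E Q ∧ FinDecomposable E Q ∧
      ∀ x, divergence Q x = μ₁ x - μ₂ x := by
  classical
  obtain ⟨hρ0, hrow, hcol⟩ := hρ
  obtain ⟨e⟩ : Nonempty (ℕ ≃ V × V) := inferInstance
  have hsum : Summable ρ := by
    rw [summable_prod_of_nonneg hρ0]
    exact ⟨fun x => (hrow x).summable, by simpa [(hrow _).tsum_eq] using h₁.2.summable⟩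
  have hpath : ∀ p : V × V, ∃ l : List V, ∃ hne : l ≠ [], IsDipath E l ∧ l.Nodup ∧
      (ρ p ≠ 0 → l.head hne = p.1 ∧ l.getLast hne = p.2) := fun p => by
    by_cases hp : ρ p = 0
    · exact ⟨[p.1], by simp, ⟨by simp, List.isChain_singleton _⟩, by simp, fun h => absurd hp h⟩
    · obtain ⟨l, hne, hl⟩ := exists_dipath_of_inducedLE hacyc (hle p hp)
      exact ⟨l, hne, hl.1, hl.2.1, fun _ => hl.2.2⟩
  choose γ hne hdi hnd hends using hpath
  refine ⟨fun z => ∑' n, ρ (e n) * pathFlow (γ (e n)) z, ⟨fun z => ?_, fun z hz => ?_⟩,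
    ⟨fun n => γ (e n), fun n => ρ (e n), fun n => hdi _, fun n => hnd _, fun n => hρ0 _,
      e.summable_iff.mpr hsum, fun z => rfl⟩, fun x => ?_⟩
  · exact tsum_nonneg fun n => mul_nonneg (hρ0 _) (pathFlow_nonneg _ _)
  · simp [pathFlow_eq_zero_of_notMem (hdi _) hz]
  · rw [divergence_tsum_pathFlow (fun n => hne (e n)) (fun n => hnd (e n)) (fun n => hρ0 (e n))
      (e.summable_iff.mpr hsum)]
    congr 1
    · rw [e.tsum_eq fun p => ρ p * if x = (γ p).head (hne p) then (1 : ℝ) else 0]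
      refine HasSum.tsum_eq ?_
      rw [← (Prod.mk_right_injective x).hasSum_iff]
      · convert hrow x using 2 with y
        by_cases h : ρ (x, y) = 0
        · simp [h]
        · simp [(hends _ h).1]
      · rintro ⟨a, b⟩ hab
        by_cases h : ρ (a, b) = 0
        · simp [h]
        · have hxa : x ≠ a := by rintro rfl; exact hab ⟨b, rfl⟩
          simp [(hends _ h).1, hxa]
    · rw [e.tsum_eq fun p => ρ p * if x = (γ p).getLast (hne p) then (1 : ℝ) else 0]
      refine HasSum.tsum_eq ?_
      rw [← (Prod.mk_left_injective x).hasSum_iff]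
      · convert hcol x using 2 with y
        by_cases h : ρ (y, x) = 0
        · simp [h]
        · simp [(hends _ h).2]
      · rintro ⟨a, b⟩ hab
        by_cases h : ρ (a, b) = 0
        · simp [h]
        · have hxb : x ≠ b := by rintro rfl; exact hab ⟨a, rfl⟩
          simp [(hends _ h).2, hxb]

open Classical in
/-- Weighted Hall theorem with deficiency `D`. -/
lemma exists_transport_of_deficiency {ι : Type*} [Fintype ι] (r : ι → ι → Prop) (a b : ι → ℕ)
    (D : ℕ) (h : ∀ S : Finset ι, ∑ i ∈ S, a i ≤ (∑ j with ∃ i ∈ S, r i j, b j) + D) :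
    ∃ m : ι → ι → ℕ, (∀ i j, m i j ≠ 0 → r i j) ∧ (∀ i, ∑ j, m i j ≤ a i) ∧
      (∀ i, a i ≤ (∑ j, m i j) + D) ∧ ∀ j, ∑ i, m i j ≤ b j := by
  let R : (Σ i, Fin (a i)) → (Σ j, Fin (b j)) ⊕ Fin D → Prop :=
    fun s t => Sum.elim (fun u => r s.1 u.1) (fun _ => True) t
  obtain ⟨f, hf, hR⟩ := (Fintype.all_card_le_filter_rel_iff_exists_injective R).mp <| by
    intro A
    rcases A.eq_empty_or_nonempty with rfl | ⟨s₀, hs₀⟩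
    · simp
    let S := A.image Sigma.fst
    have hleft : A.card ≤ ∑ i ∈ S, a i := by
      calc A.card ≤ (S.sigma fun i => (Finset.univ : Finset (Fin (a i)))).card :=
            Finset.card_le_card fun s hs => by
              exact Finset.mem_sigma.mpr ⟨Finset.mem_image_of_mem Sigma.fst hs, Finset.mem_univ _⟩
        _ = ∑ i ∈ S, a i := by simp
    have hright : ((((Finset.univ.filter fun j => ∃ i ∈ S, r i j).sigma
        fun j => (Finset.univ : Finset (Fin (b j)))).disjSum
          (Finset.univ : Finset (Fin D))).card) ≤
        (Finset.univ.filter fun t => ∃ s ∈ A, R s t).card := by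
      refine Finset.card_le_card fun t ht => ?_
      rcases t with u | d
      · simp only [Finset.inl_mem_disjSum, Finset.mem_sigma, Finset.mem_filter, Finset.mem_univ,
          true_and, and_true] at ht
        obtain ⟨i, hi, hr⟩ := ht
        obtain ⟨s, hs, rfl⟩ := Finset.mem_image.mp hi
        exact Finset.mem_filter.mpr ⟨Finset.mem_univ _, s, hs, hr⟩
      · exact Finset.mem_filter.mpr ⟨Finset.mem_univ _, s₀, hs₀, trivial⟩
    refine (hleft.trans (h S)).trans (le_trans (le_of_eq ?_) hright)
    simp
  let g : (Σ i, Fin (a i)) → Option ι := fun s => Sum.elim (fun u => some u.1) (fun _ => none) (f s)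
  have hnone : ∀ i,
      (Finset.univ.filter fun k : Fin (a i) => g ⟨i, k⟩ = none).card ≤ D := fun i => by
    calc _ ≤ ((Finset.univ : Finset (Fin D)).image
          (Sum.inr : Fin D → (Σ j, Fin (b j)) ⊕ Fin D)).card := by
          refine Finset.card_le_card_of_injOn (fun k => f ⟨i, k⟩) (fun k hk => ?_)
              fun k _ l _ hkl => ?_
          · have hk' : g ⟨i, k⟩ = none := (Finset.mem_filter.mp hk).2
            rcases hfk : f ⟨i, k⟩ with u | d
            · simp [g, hfk] at hk'
            · simp [hfk]
          · simpa using hf hkl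
      _ ≤ D := Finset.card_image_le.trans (by simp)
  have hrow : ∀ i, a i = (Finset.univ.filter fun k : Fin (a i) => g ⟨i, k⟩ = none).card +
      ∑ j, (Finset.univ.filter fun k : Fin (a i) => g ⟨i, k⟩ = some j).card := fun i => by
    rw [← Fintype.sum_option fun o => (Finset.univ.filter fun k : Fin (a i) => g ⟨i, k⟩ = o).card,
      ← Finset.card_eq_sum_card_fiberwise fun _ _ => Finset.mem_coe.mpr (Finset.mem_univ _)]
    simp
  refine ⟨fun i j => (Finset.univ.filter fun k : Fin (a i) => g ⟨i, k⟩ = some j).card,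
    fun i j hij => ?_, fun i => ?_, fun i => ?_, fun j => ?_⟩
  · obtain ⟨k, hk⟩ := Finset.card_ne_zero.mp hij
    have hk' : g ⟨i, k⟩ = some j := (Finset.mem_filter.mp hk).2
    have hRk := hR ⟨i, k⟩
    rcases hfk : f ⟨i, k⟩ with u | d
    · simp only [g, hfk, Sum.elim_inl, Option.some.injEq] at hk'
      simpa [R, hfk, hk'] using hRk
    · simp [g, hfk] at hk'
  · exact (Nat.le_add_left _ _).trans (hrow i).ge
  · exact (hrow i).le.trans (by rw [add_comm]; exact Nat.add_le_add_left (hnone i) _)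
  · rw [← Finset.card_sigma]
    calc _ ≤ ((Finset.univ : Finset (Fin (b j))).image
          (fun l => (Sum.inl ⟨j, l⟩ : (Σ j, Fin (b j)) ⊕ Fin D))).card := by
          refine Finset.card_le_card_of_injOn f (fun s hs => ?_) hf.injOn
          have hs' : g s = some j := by
            rw [Finset.mem_coe, Finset.mem_sigma] at hs
            exact (Finset.mem_filter.mp hs.2).2
          rcases hfs : f s with ⟨j', l⟩ | d
          · simp only [g, hfs, Sum.elim_inl, Option.some.injEq] at hs'
            subst hs'
            simp
          · simp [g, hfs] at hs'
      _ ≤ b j := Finset.card_image_le.trans (by simp)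

open Classical in
/-- Couplings of the restrictions of `μ₁` and `μ₂` to a finite set, up to an error. -/
lemma exists_partial_coupling {E : Set (V × V)} {μ₁ μ₂ : V → ℝ} (h₁ : IsProb μ₁) (h₂ : IsProb μ₂)
    (hdom : StochDom (inducedLE E) μ₁ μ₂) (F : Finset V) {ε : ℝ} (hε : 0 < ε) :
    ∃ ρ : V → V → ℝ, (∀ x y, 0 ≤ ρ x y) ∧ (∀ x y, ρ x y ≠ 0 → inducedLE E x y) ∧
      (∀ x y, y ∉ F → ρ x y = 0) ∧ (∀ x y, x ∉ F → ρ x y = 0) ∧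
      (∀ x, ∑ y ∈ F, ρ x y ≤ μ₁ x) ∧ (∀ y, ∑ x ∈ F, ρ x y ≤ μ₂ y) ∧
      ∀ x ∈ F, μ₁ x - (1 - ∑ y ∈ F, μ₂ y) - ε ≤ ∑ y ∈ F, ρ x y := by
  obtain ⟨N, hN⟩ := exists_nat_gt ((F.card + 2) / ε)
  have hN0 : (0 : ℝ) < N := lt_of_le_of_lt (by positivity) hN
  have hNε : (F.card + 2 : ℝ) ≤ N * ε := ((div_lt_iff₀ hε).mp hN).le
  set τ : ℝ := 1 - ∑ y ∈ F, μ₂ y with hτ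
  have hτ0 : 0 ≤ τ := sub_nonneg.mpr (sum_le_hasSum F (fun y _ => h₂.1 y) h₂.2)
  let a : F → ℕ := fun x => ⌊N * μ₁ x⌋₊
  let b : F → ℕ := fun y => ⌊N * μ₂ y⌋₊
  let D : ℕ := ⌈N * τ⌉₊ + F.card
  have hup : ∀ S : Finset F, ∑ i ∈ S, μ₁ i ≤
      (∑ j with ∃ i ∈ S, inducedLE E i.1 (j : F).1, μ₂ j) + τ := fun S => by
    let U : Set V := {y | ∃ i ∈ S, inducedLE E i.1 y}
    let f : V → ℝ := U.indicator 1
    have hf0 : ∀ y, 0 ≤ f y := fun y => Set.indicator_nonneg (fun _ _ => zero_le_one) y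
    have hf1 : ∀ y, f y ≤ 1 := fun y => Set.indicator_le_self' (fun _ _ => zero_le_one) y
    have hfμ : ∀ μ : V → ℝ, IsProb μ → Summable fun y => f y * μ y := fun μ h =>
      Summable.of_nonneg_of_le (fun y => mul_nonneg (hf0 y) (h.1 y))
        (fun y => mul_le_of_le_one_left (h.1 y) (hf1 y)) h.2.summable
    have hd := hdom f ⟨1, fun y => by rw [abs_of_nonneg (hf0 y)]; exact hf1 y⟩ fun x y hxy => by
      by_cases hx : x ∈ U
      · obtain ⟨i, hi, hix⟩ := id hx
        have hy : y ∈ U := ⟨i, hi, hix.trans hxy⟩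
        simp [f, hx, hy]
      · simpa [f, hx] using hf0 y
    have hl : ∑ i ∈ S, μ₁ i ≤ ∑' y, f y * μ₁ y := by
      have := (hfμ μ₁ h₁).sum_le_tsum (S.map (Function.Embedding.subtype _))
        fun y _ => mul_nonneg (hf0 y) (h₁.1 y)
      refine le_trans (le_of_eq ?_) this
      rw [Finset.sum_map]
      refine Finset.sum_congr rfl fun i hi => ?_
      have : i.1 ∈ U := ⟨i, hi, Relation.ReflTransGen.refl⟩
      simp [f, this]
    have hr : ∑' y, f y * μ₂ y ≤ (∑ y ∈ F, f y * μ₂ y) + τ := by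
      have h := ((h₂.2.summable.sub (hfμ μ₂ h₂)).sum_le_tsum F fun y _ =>
        sub_nonneg.mpr (mul_le_of_le_one_left (h₂.1 y) (hf1 y)))
      rw [h₂.2.summable.tsum_sub (hfμ μ₂ h₂), h₂.2.tsum_eq, Finset.sum_sub_distrib] at h
      linarith
    have hF : ∑ y ∈ F, f y * μ₂ y = ∑ j with ∃ i ∈ S, inducedLE E i.1 (j : F).1, μ₂ j := by
      rw [← Finset.sum_coe_sort, Finset.sum_filter]
      refine Finset.sum_congr rfl fun j _ => ?_
      simp only [f, U, Set.indicator, Set.mem_ofPred_eq, Pi.one_apply, ite_mul, one_mul, zero_mul]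
    linarith
  obtain ⟨m, hm, hrow, hrow', hcol⟩ := exists_transport_of_deficiency
    (fun x y : F => inducedLE E x.1 y.1) a b D fun S => by
      have ha : (∑ i ∈ S, (a i : ℝ)) ≤ N * ∑ i ∈ S, μ₁ i := by
        rw [Finset.mul_sum]
        exact Finset.sum_le_sum fun i _ => Nat.floor_le (mul_nonneg hN0.le (h₁.1 i))
      set T : Finset F := Finset.univ.filter fun j => ∃ i ∈ S, inducedLE E i.1 j.1 with hT
      have hb : N * ∑ j ∈ T, μ₂ j ≤ (∑ j ∈ T, (b j : ℝ)) + F.card := by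
        have hle : ∑ j ∈ T, N * μ₂ j ≤ ∑ j ∈ T, ((b j : ℝ) + 1) :=
          Finset.sum_le_sum fun j _ => (Nat.lt_floor_add_one _).le
        have hcard : (T.card : ℝ) ≤ F.card := by
          exact_mod_cast T.card_le_univ.trans (by simp)
        rw [Finset.sum_add_distrib, Finset.sum_const, nsmul_eq_mul, mul_one] at hle
        rw [Finset.mul_sum]
        linarith
      have hS := mul_le_mul_of_nonneg_left (hup S) hN0.le
      have hc := Nat.le_ceil (N * τ)
      have : ((∑ i ∈ S, a i : ℕ) : ℝ) ≤ ((∑ j ∈ T, b j) + D : ℕ) := by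
        push_cast [D]
        linarith
      exact_mod_cast this
  let ρ : V → V → ℝ := fun x y =>
    if hx : x ∈ F then if hy : y ∈ F then (m ⟨x, hx⟩ ⟨y, hy⟩ : ℝ) / N else 0 else 0
  have hρrow : ∀ x (hx : x ∈ F), ∑ y ∈ F, ρ x y = (∑ j, m ⟨x, hx⟩ j : ℕ) / (N : ℝ) := fun x hx => by
    rw [← Finset.sum_coe_sort]
    simp [ρ, hx, Finset.sum_div]
  have hρcol : ∀ y (hy : y ∈ F), ∑ x ∈ F, ρ x y = (∑ i, m i ⟨y, hy⟩ : ℕ) / (N : ℝ) := fun y hy => by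
    rw [← Finset.sum_coe_sort]
    simp [ρ, hy, Finset.sum_div]
  have hfloor : ∀ t : ℝ, 0 ≤ t → (⌊N * t⌋₊ : ℝ) / N ≤ t := fun t ht => by
    rw [div_le_iff₀ hN0, mul_comm t]
    exact Nat.floor_le (mul_nonneg hN0.le ht)
  refine ⟨ρ, fun x y => ?_, fun x y hxy => ?_, fun x y hy => ?_, fun x y hx => ?_, fun x => ?_,
    fun y => ?_, fun x hx => ?_⟩
  · simp only [ρ]
    split_ifs <;> positivity
  · by_cases hx : x ∈ F
    · by_cases hy : y ∈ F
      · exact hm ⟨x, hx⟩ ⟨y, hy⟩ fun h => hxy (by simp [ρ, hx, hy, h])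
      · exact absurd (by simp [ρ, hy]) hxy
    · exact absurd (by simp [ρ, hx]) hxy
  · simp [ρ, hy]
  · simp [ρ, hx]
  · by_cases hx : x ∈ F
    · rw [hρrow x hx]
      refine le_trans ?_ (hfloor _ (h₁.1 x))
      gcongr
      exact hrow ⟨x, hx⟩
    · simpa [ρ, hx] using h₁.1 x
  · by_cases hy : y ∈ F
    · rw [hρcol y hy]
      refine le_trans ?_ (hfloor _ (h₂.1 y))
      gcongr
      exact hcol ⟨y, hy⟩
    · simpa [ρ, hy] using h₂.1 y
  · rw [hρrow x hx, le_div_iff₀ hN0]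
    have h := hrow' ⟨x, hx⟩
    have h' : (a ⟨x, hx⟩ : ℝ) ≤ (∑ j, m ⟨x, hx⟩ j : ℕ) + (D : ℝ) := by exact_mod_cast h
    have hD : (D : ℝ) ≤ N * τ + 1 + F.card := by
      push_cast [D]
      linarith [(Nat.ceil_lt_add_one (mul_nonneg hN0.le hτ0)).le]
    have ha : N * μ₁ x ≤ a ⟨x, hx⟩ + 1 := (Nat.lt_floor_add_one _).le
    nlinarith

lemma exists_coupling_of_stochDom {E : Set (V × V)} {μ₁ μ₂ : V → ℝ}
    (h₁ : IsProb μ₁) (h₂ : IsProb μ₂) (hdom : StochDom (inducedLE E) μ₁ μ₂) :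
    ∃ ρ : V × V → ℝ, IsCoupling μ₁ μ₂ ρ ∧ ∀ p : V × V, ρ p ≠ 0 → inducedLE E p.1 p.2 := by
  classical
  have hε : ∀ n : ℕ, (0 : ℝ) < 1 / ((n : ℝ) + 1) := fun n => Nat.one_div_pos_of_nat
  choose σ hσ0 hσle hσy hσx hσrow hσcol hσlow using
    fun i : Finset V × ℕ => exists_partial_coupling h₁ h₂ hdom i.1 (hε i.2)
  have hσ₁ : ∀ i x y, σ i x y ≤ μ₁ x := fun i x y => by
    by_cases hy : y ∈ i.1
    · exact (Finset.single_le_sum (fun z _ => hσ0 i x z) hy).trans (hσrow i x)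
    · exact (hσy i x y hy).le.trans (h₁.1 x)
  have hσ₂ : ∀ i x y, σ i x y ≤ μ₂ y := fun i x y => by
    by_cases hx : x ∈ i.1
    · exact (Finset.single_le_sum (fun z _ => hσ0 i z y) hx).trans (hσcol i y)
    · exact (hσx i x y hx).le.trans (h₂.1 y)
  let U : Ultrafilter (Finset V × ℕ) := Ultrafilter.of (Filter.atTop ×ˢ Filter.atTop)
  have hU : (U : Filter (Finset V × ℕ)) ≤ Filter.atTop ×ˢ Filter.atTop := Ultrafilter.of_le _
  have hfst : Filter.Tendsto Prod.fst (U : Filter (Finset V × ℕ)) Filter.atTop :=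
    Filter.tendsto_fst.mono_left hU
  have hsnd : Filter.Tendsto Prod.snd (U : Filter (Finset V × ℕ)) Filter.atTop :=
    Filter.tendsto_snd.mono_left hU
  have hlim : ∀ x y, ∃ c, Filter.Tendsto (fun i => σ i x y) U (nhds c) := fun x y => by
    obtain ⟨c, -, hc⟩ := isCompact_iff_ultrafilter_le_nhds.mp (isCompact_Icc (a := 0) (b := μ₁ x))
      (U.map fun i => σ i x y) (Filter.tendsto_principal.mpr <|
        Filter.Eventually.of_forall fun i => ⟨hσ0 i x y, hσ₁ i x y⟩)
    exact ⟨c, hc⟩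
  choose ρ hρ using hlim
  have hρ0 : ∀ x y, 0 ≤ ρ x y := fun x y =>
    ge_of_tendsto (hρ x y) (Filter.Eventually.of_forall fun i => hσ0 i x y)
  have hρ₁ : ∀ x y, ρ x y ≤ μ₁ x := fun x y =>
    le_of_tendsto (hρ x y) (Filter.Eventually.of_forall fun i => hσ₁ i x y)
  have hρ₂ : ∀ x y, ρ x y ≤ μ₂ y := fun x y =>
    le_of_tendsto (hρ x y) (Filter.Eventually.of_forall fun i => hσ₂ i x y)
  have hlimrow : ∀ x, Filter.Tendsto (fun i => ∑' y, σ i x y) U (nhds (∑' y, ρ x y)) := fun x =>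
    tendsto_tsum_of_dominated_convergence h₂.2.summable (hρ x) <|
      Filter.Eventually.of_forall fun i y => by
        rw [Real.norm_of_nonneg (hσ0 i x y)]
        exact hσ₂ i x y
  have hlimcol : ∀ y, Filter.Tendsto (fun i => ∑' x, σ i x y) U (nhds (∑' x, ρ x y)) := fun y =>
    tendsto_tsum_of_dominated_convergence h₁.2.summable (fun x => hρ x y) <|
      Filter.Eventually.of_forall fun i x => by
        rw [Real.norm_of_nonneg (hσ0 i x y)]
        exact hσ₁ i x y
  have hrow : ∀ x, HasSum (ρ x) (μ₁ x) := fun x => by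
    have hs : Summable (ρ x) := Summable.of_nonneg_of_le (hρ0 x) (hρ₂ x) h₂.2.summable
    have hsum : ∀ i, ∑' y, σ i x y = ∑ y ∈ i.1, σ i x y := fun i => tsum_eq_sum (hσy i x)
    have hlim := hlimrow x
    simp only [hsum] at hlim
    have htail : Filter.Tendsto (fun i : Finset V × ℕ =>
        μ₁ x - (1 - ∑ y ∈ i.1, μ₂ y) - 1 / ((i.2 : ℝ) + 1)) U (nhds (μ₁ x - (1 - 1) - 0)) :=
      (tendsto_const_nhds.sub (tendsto_const_nhds.sub (h₂.2.comp hfst))).sub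
        (tendsto_one_div_add_atTop_nhds_zero_nat.comp hsnd)
    have hge := le_of_tendsto_of_tendsto htail hlim <|
      (hfst.eventually (Filter.eventually_ge_atTop {x})).mono fun i hi =>
        hσlow i x (hi (Finset.mem_singleton_self x))
    have hle := le_of_tendsto hlim (Filter.Eventually.of_forall fun i => hσrow i x)
    have heq : ∑' y, ρ x y = μ₁ x := le_antisymm hle (by linarith)
    exact heq ▸ hs.hasSum
  have hcols : ∀ y, Summable fun x => ρ x y := fun y =>
    Summable.of_nonneg_of_le (fun x => hρ0 x y) (fun x => hρ₁ x y) h₁.2.summable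
  have hcolle : ∀ y, ∑' x, ρ x y ≤ μ₂ y := fun y => by
    refine le_of_tendsto (hlimcol y) (Filter.Eventually.of_forall fun i => ?_)
    rw [tsum_eq_sum fun x => hσx i x y]
    exact hσcol i y
  have hjoint : Summable (Function.uncurry ρ) :=
    (summable_prod_of_nonneg fun p => hρ0 p.1 p.2).mpr
      ⟨fun x => (hrow x).summable, by
        simpa [Function.uncurry, (hrow _).tsum_eq] using h₁.2.summable⟩
  have hcolsum : HasSum (fun y => ∑' x, ρ x y) 1 := by
    have h := hjoint.prod_symm.prod.hasSum
    simp only [Prod.swap, Function.uncurry] at h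
    rwa [hjoint.tsum_comm, tsum_congr fun x => (hrow x).tsum_eq, h₁.2.tsum_eq] at h
  have hdefect : (fun y => μ₂ y - ∑' x, ρ x y) = 0 :=
    (hasSum_zero_iff_of_nonneg fun y => sub_nonneg.mpr (hcolle y)).mp <| by
      simpa using h₂.2.sub hcolsum
  refine ⟨Function.uncurry ρ, ⟨fun p => hρ0 p.1 p.2, hrow, fun y => ?_⟩, fun p hp => ?_⟩
  · rw [sub_eq_zero.mp (congrFun hdefect y)]
    exact (hcols y).hasSum
  · by_contra hle
    refine hp (tendsto_nhds_unique (hρ p.1 p.2) ?_)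
    have hzero : ∀ i, σ i p.1 p.2 = 0 := fun i => by_contra fun h => hle (hσle i _ _ h)
    simp only [hzero]
    exact tendsto_const_nhds

/-- **Strassen's theorem with a third equivalent statement, countably infinite case.**
For a countably infinite poset described by an acyclic digraph `(V, E)` whose transitive
closure induces the order, the following are equivalent: (1) `μ₁ ⪯ μ₂`; (2) there is a
compatible coupling of `μ₁, μ₂`; (3) there is a finitely decomposable flow `Q` on `(V, E)`
with `div Q = μ₁ - μ₂`. -/
theorem strassen_countable {V : Type*} [Countable V] [Infinite V]
    (E : Set (V × V)) (hloop : ∀ x : V, (x, x) ∉ E) (hacyc : AcyclicRel (edgeRel E))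
    (μ₁ μ₂ : V → ℝ) (h₁ : IsProb μ₁) (h₂ : IsProb μ₂) :
    (StochDom (inducedLE E) μ₁ μ₂ ↔
      ∃ ρ : V × V → ℝ, IsCoupling μ₁ μ₂ ρ ∧
        ∀ p : V × V, ρ p ≠ 0 → inducedLE E p.1 p.2) ∧
    (StochDom (inducedLE E) μ₁ μ₂ ↔
      ∃ Q : V × V → ℝ, IsFlow E Q ∧ FinDecomposable E Q ∧
        ∀ x, divergence Q x = μ₁ x - μ₂ x) := by
  have hcoupling := exists_coupling_of_stochDom h₁ h₂ (E := E)
  have hflow : (∃ ρ : V × V → ℝ, IsCoupling μ₁ μ₂ ρ ∧ ∀ p : V × V, ρ p ≠ 0 → inducedLE E p.1 p.2) →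
      ∃ Q : V × V → ℝ, IsFlow E Q ∧ FinDecomposable E Q ∧
        ∀ x, divergence Q x = μ₁ x - μ₂ x :=
    fun ⟨_, hρ, hle⟩ => exists_finDecomposable_of_coupling hacyc h₁ hρ hle
  have hstoch : (∃ Q : V × V → ℝ, IsFlow E Q ∧ FinDecomposable E Q ∧
      ∀ x, divergence Q x = μ₁ x - μ₂ x) → StochDom (inducedLE E) μ₁ μ₂ :=
    fun ⟨_, _, hQ, hdiv⟩ => stochDom_of_finDecomposable h₁ h₂ hQ hdiv
  exact ⟨⟨hcoupling, fun h => hstoch (hflow h)⟩, ⟨fun h => hflow (hcoupling h), hstoch⟩⟩
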